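/- arXiv:1412.8137 — 2 statements merged into one kernel-verified Lean document; each statement's English description precedes it below -/
import Mathlib

section
/- The Petersen graph has maximum Randić energy among all 3-regular simple graphs on 10 vertices: for every 3-regular simple graph G on 10 vertices, RE(G) ≤ 16/3. -/
open scoped Classical

/-- The energy of a real matrix: the sum of the absolute values of its eigenvalues
(with multiplicity), when the matrix is Hermitian (= symmetric). -/
noncomputable def matrixEnergy {n : Type*} [Fintype n] (A : Matrix n n ℝ) : ℝ :=
  if h : A.IsHermitian then ∑ i, |h.eigenvalues i| else 0

/-- The energy of a finite simple graph: the sum of the absolute values of the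
eigenvalues of its adjacency matrix. -/
noncomputable def SimpleGraph.energy {V : Type*} [Fintype V] (G : SimpleGraph V) : ℝ :=
  matrixEnergy (G.adjMatrix ℝ)

/-- The Randić matrix of a finite simple graph: `(i,j)`-entry `1/√(dᵢ dⱼ)` if `i ~ j`, else `0`. -/
noncomputable def SimpleGraph.randicMatrix {V : Type*} [Fintype V] (G : SimpleGraph V) :
    Matrix V V ℝ :=
  Matrix.of fun i j =>
    if G.Adj i j then 1 / Real.sqrt ((G.degree i : ℝ) * (G.degree j : ℝ)) else 0

/-- The Randić energy of a finite simple graph: the sum of the absolute values of the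
eigenvalues of its Randić matrix. -/
noncomputable def SimpleGraph.randicEnergy {V : Type*} [Fintype V] (G : SimpleGraph V) : ℝ :=
  matrixEnergy G.randicMatrix

/-- The Randić characteristic polynomial `det (λ I - R(G))`. -/
noncomputable def SimpleGraph.randicCharpoly {V : Type*} [Fintype V] (G : SimpleGraph V) :
    Polynomial ℝ :=
  G.randicMatrix.charpoly

namespace CubicTen

/-- The masks with `p` bits of which exactly `w` are set. -/
def masks : ℕ → ℕ → List ℕ
  | 0, 0 => [0]
  | 0, _ + 1 => []
  | p + 1, 0 => masks p 0
  | p + 1, w + 1 => masks p (w + 1) ++ (masks p w).map (Nat.add (Nat.pow 2 p))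

/-- A bit as a number. -/
def bit (m i : ℕ) : ℕ := Nat.mod (Nat.shiftRight m i) 2

/-- Number of bits set in a ten-bit mask. -/
def pop (m : ℕ) : ℕ :=
  Nat.add (bit m 0) (Nat.add (bit m 1) (Nat.add (bit m 2) (Nat.add (bit m 3) (Nat.add (bit m 4)
  (Nat.add (bit m 5) (Nat.add (bit m 6) (Nat.add (bit m 7) (Nat.add (bit m 8) (bit m 9)))))))))

/-- Sum of `f` over a list. -/
def lsum (f : ℕ → ℕ) : List ℕ → ℕ
  | [] => 0
  | x :: xs => Nat.add (f x) (lsum f xs)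

/-- Walks of length three between the vertices with rows `x` and `y`. -/
def walk3 (y : ℕ) : List ℕ → ℕ → ℕ
  | [], _ => 0
  | r :: rs, x => Nat.add (Nat.mul (Nat.mod x 2) (pop (Nat.land r y)))
      (walk3 y rs (Nat.div x 2))

/-- Trace of the fourth power. -/
def mom4 (rows : List ℕ) : ℕ :=
  lsum (fun x => lsum (fun y => Nat.pow (pop (Nat.land x y)) 2) rows) rows

/-- Trace of the sixth power. -/
def mom6 (rows : List ℕ) : ℕ :=
  lsum (fun x => lsum (fun y => Nat.pow (walk3 y rows x) 2) rows) rows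

/-- The leaf test. -/
def check (rows : List ℕ) : Bool :=
  or (Nat.ble 174 (mom4 rows)) (Nat.ble (Nat.add (mom6 rows) 810) (Nat.mul 12 (mom4 rows)))

/-- The smallest `k'` such that all bits in `[k', k)` are set. -/
def low (S : ℕ) : ℕ → ℕ
  | 0 => 0
  | k + 1 => cond (Nat.beq (bit S k) 1) (low S k) (Nat.succ k)

/-- The part of the row of `p` already determined by earlier rows. -/
def known (p : ℕ) : List ℕ → ℕ
  | [] => 0
  | r :: rs => Nat.add (bit r p) (Nat.mul 2 (known p rs))

/-- Apply a function to an evaluated number. -/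
def force {α : Type} (f : ℕ → α) : ℕ → α
  | 0 => f 0
  | n + 1 => f (Nat.succ n)

/-- Conjunction over a list. -/
def lall (f : ℕ → Bool) : List ℕ → Bool
  | [] => true
  | x :: xs => and (f x) (lall f xs)

/-- Smaller of two numbers. -/
def mn (a b : ℕ) : ℕ := cond (Nat.ble a b) a b

/-- Search over all cubic graphs on ten vertices, up to relabelling. -/
def search : ℕ → ℕ → List ℕ → Bool
  | 0, _, rows => check rows
  | p + 1, k, rows =>
      force (fun k => force (fun K => cond (Nat.ble (pop K) 3)
        (lall (fun L => force (fun k' =>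
            cond (Nat.beq (Nat.mod L (Nat.pow 2 k')) 0)
              (force (fun S => search p k' (S :: rows)) (Nat.add L (Nat.mul K (Nat.pow 2 p))))
              true) (low L k))
          (masks p (Nat.sub 3 (pop K)))) true) (Nat.mul 2 (known p rows))) (mn k p)

theorem search_true : search 10 10 [] = true := by
  decide +kernel

theorem mem_masks : ∀ p < 10, ∀ m < 2 ^ p, m ∈ masks p (pop m) := by
  decide +kernel

theorem pop_split : ∀ S < 1024, ∀ p < 10, pop (S % 2 ^ p) + pop (S / 2 ^ p) = pop S := by
  decide +kernel

theorem bit_eq (m i : ℕ) : bit m i = (m.testBit i).toNat := by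
  have h : bit m i = m / 2 ^ i % 2 := by
    unfold bit
    rw [← Nat.shiftRight_eq_div_pow]
    rfl
  rw [h, Nat.testBit_eq_decide_div_mod_eq]
  rcases Nat.mod_two_eq_zero_or_one (m / 2 ^ i) with h | h <;> simp [h]

theorem force_eq {α : Type} (f : ℕ → α) (n : ℕ) : force f n = f n := by
  cases n <;> rfl

theorem mn_eq (a b : ℕ) : mn a b = min a b := by
  unfold mn
  cases h : Nat.ble a b
  · have : ¬ a ≤ b := by
      intro h'
      rw [Nat.ble_eq_true_of_le h'] at h
      cases h
    simp; omega
  · have := Nat.le_of_ble_eq_true h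
    simp [this]

theorem lall_iff (f : ℕ → Bool) (l : List ℕ) : lall f l = true ↔ ∀ x ∈ l, f x = true := by
  induction l with
  | nil => simp [lall]
  | cons x xs ih => simp [lall, ih]

theorem low_eq (L : ℕ) (k' : ℕ) : ∀ k, k' ≤ k → (∀ j < k, L.testBit j = true ↔ k' ≤ j) →
    low L k = k' := by
  intro k
  induction k with
  | zero => intro h _; simp [low]; omega
  | succ k ih =>
    intro hk h
    have h1 := h k (by omega)
    unfold low
    rw [bit_eq]
    by_cases hkk : k' ≤ k
    · rw [h1.2 hkk]
      simpa using ih hkk (fun j hj => h j (by omega))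
    · have : L.testBit k = false := by
        cases hb : L.testBit k
        · rfl
        · exact absurd (h1.1 hb) hkk
      rw [this]
      change k + 1 = k'
      omega

/-- Row of `v` as a mask. -/
def row (a : ℕ → ℕ → Bool) (v : ℕ) : ℕ := Nat.ofBits (fun j : Fin 10 => a v j)

theorem row_lt (a : ℕ → ℕ → Bool) (v : ℕ) : row a v < 1024 := by
  have := Nat.ofBits_lt_two_pow (fun j : Fin 10 => a v j)
  simpa [row] using this

theorem testBit_row (a : ℕ → ℕ → Bool) (v j : ℕ) (hj : j < 10) :
    (row a v).testBit j = a v j := by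
  simp [row, hj]

theorem bit_row (a : ℕ → ℕ → Bool) (v j : ℕ) (hj : j < 10) :
    bit (row a v) j = (a v j).toNat := by
  rw [bit_eq, testBit_row a v j hj]

theorem pop_eq (m : ℕ) : pop m = ∑ j ∈ Finset.range 10, (m.testBit j).toNat := by
  simp only [pop, bit_eq, Finset.sum_range_succ, Finset.sum_range_zero, Nat.add_eq]
  ring

theorem pop_row (a : ℕ → ℕ → Bool) (v : ℕ) :
    pop (row a v) = ∑ j ∈ Finset.range 10, (a v j).toNat := by
  rw [pop_eq]
  refine Finset.sum_congr rfl fun j hj => ?_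
  rw [testBit_row a v j (Finset.mem_range.1 hj)]

theorem known_eq (a : ℕ → ℕ → Bool) (hs : ∀ i j, a i j = a j i) (p : ℕ) (hp : p < 10) :
    ∀ m v, v + m = 10 → known p ((List.range' v m).map (row a)) = row a p / 2 ^ v := by
  intro m
  induction m with
  | zero =>
    intro v hv
    have : v = 10 := by omega
    subst this
    have := row_lt a p
    simp [known]
    omega
  | succ m ih =>
    intro v hv
    rw [List.range'_succ, List.map_cons, known, ih (v + 1) (by omega), bit_row a v p hp, hs v p,
      ← bit_row a p v (by omega)]
    have h : bit (row a p) v = row a p / 2 ^ v % 2 := by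
      unfold bit
      rw [← Nat.shiftRight_eq_div_pow]
      rfl
    rw [h, pow_succ, ← Nat.div_div_eq_div_mul, Nat.add_eq, Nat.mul_eq]
    omega

theorem perm_exists (k : ℕ) : ∀ P : ℕ → Prop, ∃ σ : Equiv.Perm ℕ, (∀ j, k ≤ j → σ j = j) ∧
    ∃ k' ≤ k, ∀ j < k, P (σ j) ↔ k' ≤ j := by
  induction k with
  | zero => intro P; exact ⟨1, by simp, 0, le_refl _, by simp⟩
  | succ k ih =>
    have key : ∀ P : ℕ → Prop, P k → ∃ σ : Equiv.Perm ℕ, (∀ j, k + 1 ≤ j → σ j = j) ∧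
        ∃ k' ≤ k + 1, ∀ j < k + 1, P (σ j) ↔ k' ≤ j := by
      intro P hP
      obtain ⟨σ, h1, k', hk', h2⟩ := ih P
      refine ⟨σ, fun j hj => h1 j (by omega), k', by omega, fun j hj => ?_⟩
      by_cases hjk : j = k
      · subst hjk
        rw [h1 j le_rfl]
        simp [hP, hk']
      · exact h2 j (by omega)
    intro P
    by_cases hex : ∃ i < k + 1, P i
    · obtain ⟨i, hi, hPi⟩ := hex
      obtain ⟨σ, h1, k', hk', h2⟩ := key (fun x => P (Equiv.swap i k x)) (by simpa using hPi)
      refine ⟨σ.trans (Equiv.swap i k), fun j hj => ?_, k', hk', fun j hj => ?_⟩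
      · rw [Equiv.trans_apply, h1 j hj, Equiv.swap_apply_of_ne_of_ne (by omega) (by omega)]
      · exact h2 j hj
    · push Not at hex
      refine ⟨1, by simp, k + 1, le_rfl, fun j hj => ?_⟩
      have := hex j hj
      simp [this]; omega

/-- Codegree. -/
def cod (a : ℕ → ℕ → Bool) (i j : ℕ) : ℕ :=
  ∑ l ∈ Finset.range 10, (a i l).toNat * (a l j).toNat

/-- Number of walks of length three. -/
def w3 (a : ℕ → ℕ → Bool) (i j : ℕ) : ℕ :=
  ∑ l ∈ Finset.range 10, (a i l).toNat * cod a l j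

def M4 (a : ℕ → ℕ → Bool) : ℕ :=
  ∑ i ∈ Finset.range 10, ∑ j ∈ Finset.range 10, cod a i j ^ 2

def M6 (a : ℕ → ℕ → Bool) : ℕ :=
  ∑ i ∈ Finset.range 10, ∑ j ∈ Finset.range 10, w3 a i j ^ 2

theorem sum_perm (σ : Equiv.Perm ℕ) (hσ : ∀ j, 10 ≤ j → σ j = j) (f : ℕ → ℕ) :
    ∑ i ∈ Finset.range 10, f (σ i) = ∑ i ∈ Finset.range 10, f i := by
  apply Equiv.Perm.sum_comp
  intro x hx
  by_contra h
  simp at h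
  exact hx (hσ x h)

theorem M_perm (a : ℕ → ℕ → Bool) (σ : Equiv.Perm ℕ) (hσ : ∀ j, 10 ≤ j → σ j = j) :
    M4 (fun i j => a (σ i) (σ j)) = M4 a ∧ M6 (fun i j => a (σ i) (σ j)) = M6 a := by
  have hs := sum_perm σ hσ
  have h1 : ∀ i j, cod (fun i j => a (σ i) (σ j)) i j = cod a (σ i) (σ j) := fun i j =>
    hs (fun l => (a (σ i) l).toNat * (a l (σ j)).toNat)
  have h2 : ∀ i j, w3 (fun i j => a (σ i) (σ j)) i j = w3 a (σ i) (σ j) := fun i j => by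
    unfold w3
    simp_rw [h1]
    exact hs (fun l => (a (σ i) l).toNat * cod a l (σ j))
  constructor
  · unfold M4
    simp_rw [h1]
    rw [hs (fun i => ∑ j ∈ Finset.range 10, cod a i (σ j) ^ 2)]
    exact Finset.sum_congr rfl fun i _ => hs (fun j => cod a i j ^ 2)
  · unfold M6
    simp_rw [h2]
    rw [hs (fun i => ∑ j ∈ Finset.range 10, w3 a i (σ j) ^ 2)]
    exact Finset.sum_congr rfl fun i _ => hs (fun j => w3 a i j ^ 2)

theorem lsum_rows (a : ℕ → ℕ → Bool) (f : ℕ → ℕ) :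
    lsum f ((List.range' 0 10).map (row a)) = ∑ i ∈ Finset.range 10, f (row a i) := by
  simp only [List.range', List.map, lsum, Finset.sum_range_succ, Finset.sum_range_zero, Nat.add_eq]
  ring

theorem pop_land (a : ℕ → ℕ → Bool) (hs : ∀ i j, a i j = a j i) (i j : ℕ) :
    pop (Nat.land (row a i) (row a j)) = cod a i j := by
  rw [pop_eq]
  refine Finset.sum_congr rfl fun l hl => ?_
  have h : Nat.land (row a i) (row a j) = row a i &&& row a j := rfl
  have hl := Finset.mem_range.1 hl
  rw [h, Nat.testBit_land, testBit_row a i l hl, testBit_row a j l hl, hs l j]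
  cases a i l <;> cases a j l <;> rfl

theorem walk3_eq (y : ℕ) (g : ℕ → ℕ) : ∀ m v x, walk3 y ((List.range' v m).map g) x =
    ∑ l ∈ Finset.range m, bit x l * pop (Nat.land (g (v + l)) y) := by
  intro m
  induction m with
  | zero => intro v x; simp [walk3]
  | succ m ih =>
    intro v x
    rw [List.range'_succ, List.map_cons, walk3, ih, Finset.sum_range_succ', Nat.add_eq, Nat.mul_eq,
      add_comm]
    congr 1
    refine Finset.sum_congr rfl fun l _ => ?_
    have : bit (Nat.div x 2) l = bit x (l + 1) := by
      rw [bit_eq, bit_eq, Nat.testBit_succ]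
      rfl
    rw [this, show v + 1 + l = v + (l + 1) by ring]

theorem check_sound (a : ℕ → ℕ → Bool) (hs : ∀ i j, a i j = a j i)
    (h : check ((List.range' 0 10).map (row a)) = true) :
    174 ≤ M4 a ∨ M6 a + 810 ≤ 12 * M4 a := by
  have h4 : mom4 ((List.range' 0 10).map (row a)) = M4 a := by
    unfold mom4 M4
    rw [lsum_rows]
    refine Finset.sum_congr rfl fun i _ => ?_
    rw [lsum_rows]
    refine Finset.sum_congr rfl fun j _ => ?_
    rw [pop_land a hs]
    rfl
  have h6 : mom6 ((List.range' 0 10).map (row a)) = M6 a := by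
    unfold mom6 M6
    rw [lsum_rows]
    refine Finset.sum_congr rfl fun i _ => ?_
    rw [lsum_rows]
    refine Finset.sum_congr rfl fun j _ => ?_
    rw [walk3_eq]
    have : (∑ l ∈ Finset.range 10, bit (row a i) l * pop (Nat.land (row a (0 + l)) (row a j)))
        = w3 a i j := by
      refine Finset.sum_congr rfl fun l hl => ?_
      rw [zero_add, pop_land a hs, bit_row a i l (Finset.mem_range.1 hl)]
    rw [this]
    rfl
  unfold check at h
  rw [h4, h6, Bool.or_eq_true] at h
  rcases h with h | h
  · exact Or.inl (Nat.le_of_ble_eq_true h)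
  · exact Or.inr (Nat.le_of_ble_eq_true h)

theorem search_sound : ∀ (n k : ℕ) (a : ℕ → ℕ → Bool), (∀ i j, a i j = a j i) →
    (∀ i, a i i = false) → (∀ i < 10, ∑ j ∈ Finset.range 10, (a i j).toNat = 3) → n ≤ 10 →
    (∀ v, n ≤ v → v < 10 → ∀ j < k, a v j = false) →
    search n k ((List.range' n (10 - n)).map (row a)) = true →
    174 ≤ M4 a ∨ M6 a + 810 ≤ 12 * M4 a := by
  intro n
  induction n with
  | zero =>
    intro k a hs _ _ _ _ h
    apply check_sound a hs
    rw [search] at h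
    exact h
  | succ p ih =>
    intro k a hs hirr hreg hn hund h
    obtain ⟨σ, hσ, k', hk', hP⟩ := perm_exists (min k p) (fun j => a p j = true)
    have hσ10 : ∀ j, 10 ≤ j → σ j = j := fun j hj => hσ j (by omega)
    have hσlt : ∀ j, j < min k p → σ j < min k p := by
      intro j hj
      by_contra hc
      have h1 := hσ (σ j) (by omega)
      have h2 := σ.injective h1
      omega
    have hp : σ p = p := hσ p (by omega)
    obtain ⟨e4, e6⟩ := M_perm a σ hσ10
    rw [← e4, ← e6]
    set a' : ℕ → ℕ → Bool := fun i j => a (σ i) (σ j) with ha'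
    have hs' : ∀ i j, a' i j = a' j i := fun i j => hs _ _
    have hirr' : ∀ i, a' i i = false := fun i => hirr _
    have hreg' : ∀ i < 10, ∑ j ∈ Finset.range 10, (a' i j).toNat = 3 := by
      intro i hi
      have h1 : σ i < 10 := by
        by_contra hc
        have h1 := hσ10 (σ i) (by omega)
        have h2 := σ.injective h1
        omega
      rw [← hreg (σ i) h1]
      exact sum_perm σ hσ10 (fun j => (a (σ i) j).toNat)
    have hrow : ∀ v, p + 1 ≤ v → v < 10 → row a v = row a' v := by
      intro v hv hv'
      refine congrArg (Nat.ofBits (n := 10)) (funext fun j => ?_)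
      simp only [ha']
      rw [hσ v (by omega)]
      by_cases hj : min k p ≤ (j : ℕ)
      · rw [hσ j hj]
      · have := hσlt j (by omega)
        rw [hund v hv hv' j (by omega), hund v hv hv' (σ j) (by omega)]
    have hrows : (List.range' (p + 1) (10 - (p + 1))).map (row a) =
        (List.range' (p + 1) (10 - (p + 1))).map (row a') := by
      apply List.map_congr_left
      intro v hv
      rw [List.mem_range'_1] at hv
      exact hrow v hv.1 (by omega)
    rw [hrows] at h
    have hb : ∀ j < min k p, a' p j = true ↔ k' ≤ j := by
      intro j hj
      rw [← hP j hj]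
      simp only [ha', hp]
    refine ih k' a' hs' hirr' hreg' (by omega) ?_ ?_
    · intro v hv hv' j hj
      by_cases hvp : v = p
      · subst hvp
        have := hb j (by omega)
        cases hc : a' v j
        · rfl
        · exact absurd (this.1 hc) (by omega)
      · have h1 := hσlt j (by omega)
        simp only [ha']
        rw [hσ v (by omega)]
        exact hund v (by omega) hv' _ (by omega)
    · have hS := row_lt a' p
      have hKK : row a' p / 2 ^ p = 2 * (row a' p / 2 ^ (p + 1)) := by
        have h1 := bit_row a' p p (by omega)
        have h2 : bit (row a' p) p = row a' p / 2 ^ p % 2 := by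
          unfold bit
          rw [← Nat.shiftRight_eq_div_pow]
          rfl
        rw [hirr' p, h2] at h1
        rw [pow_succ, ← Nat.div_div_eq_div_mul]
        simp at h1
        omega
      have hK : Nat.mul 2 (known p ((List.range' (p + 1) (10 - (p + 1))).map (row a'))) =
          row a' p / 2 ^ p := by
        rw [known_eq a' hs' p (by omega) _ _ (by omega), hKK, Nat.mul_eq]
      have hpop := pop_split (row a' p) hS p (by omega)
      rw [pop_row a' p, hreg' p (by omega)] at hpop
      have hmem := mem_masks p (by omega) (row a' p % 2 ^ p) (Nat.mod_lt _ (by positivity))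
      rw [show pop (row a' p % 2 ^ p) = Nat.sub 3 (pop (row a' p / 2 ^ p)) by
        rw [Nat.sub_eq]; omega] at hmem
      have hbit : ∀ j < p, (row a' p % 2 ^ p).testBit j = a' p j := by
        intro j hj
        rw [Nat.testBit_mod_two_pow, testBit_row a' p j (by omega)]
        simp [hj]
      have hlow : low (row a' p % 2 ^ p) (min k p) = k' := by
        apply low_eq _ _ _ hk'
        intro j hj
        rw [hbit j (by omega)]
        exact hb j hj
      have hmod : Nat.mod (row a' p % 2 ^ p) (Nat.pow 2 k') = 0 := by
        change (row a' p % 2 ^ p) % 2 ^ k' = 0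
        apply Nat.eq_of_testBit_eq
        intro j
        rw [Nat.testBit_mod_two_pow, Nat.zero_testBit]
        by_cases hj : j < k'
        · rw [hbit j (by omega)]
          have := hb j (by omega)
          cases hc : a' p j
          · simp
          · exact absurd (this.1 hc) (by omega)
        · simp [hj]
      unfold search at h
      rw [force_eq, force_eq, mn_eq, hK] at h
      have hle : Nat.ble (pop (row a' p / 2 ^ p)) 3 = true :=
        Nat.ble_eq_true_of_le (by omega)
      rw [hle, cond_true, lall_iff] at h
      have h := h _ hmem
      rw [force_eq, hlow, hmod, show Nat.beq 0 0 = true from rfl, cond_true, force_eq] at h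
      have hsum : Nat.add (row a' p % 2 ^ p) (Nat.mul (row a' p / 2 ^ p) (Nat.pow 2 p)) =
          row a' p := by
        change row a' p % 2 ^ p + row a' p / 2 ^ p * 2 ^ p = row a' p
        exact Nat.mod_add_div' _ _
      rw [hsum] at h
      rw [show 10 - p = (10 - (p + 1)) + 1 by omega, List.range'_succ, List.map_cons]
      exact h

theorem main_nat (a : ℕ → ℕ → Bool) (hs : ∀ i j, a i j = a j i)
    (hirr : ∀ i, a i i = false) (hreg : ∀ i < 10, ∑ j ∈ Finset.range 10, (a i j).toNat = 3) :
    174 ≤ M4 a ∨ M6 a + 810 ≤ 12 * M4 a :=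
  search_sound 10 10 a hs hirr hreg le_rfl (fun v h1 h2 => by omega) (by
    rw [Nat.sub_self, List.range'_zero, List.map_nil]
    exact search_true)

theorem trace_pow {V : Type*} [Fintype V] {R : Matrix V V ℝ} (h : R.IsHermitian)
    (k : ℕ) : (R ^ k).trace = ∑ i, h.eigenvalues i ^ k := by
  conv_lhs => rw [h.spectral_theorem]
  rw [← map_pow, Matrix.diagonal_pow, Unitary.conjStarAlgAut_apply, Matrix.trace_mul_cycle]
  simp [Matrix.trace_diagonal]

theorem trace_four {V : Type*} [Fintype V] (A : Matrix V V ℝ) (h : ∀ x y, A x y = A y x) :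
    (A ^ 4).trace = ∑ x, ∑ y, (∑ z, A x z * A z y) ^ 2 := by
  have hT : A.transpose = A := by ext x y; exact h y x
  have : A ^ 4 = (A * A) * (A * A).transpose := by
    rw [Matrix.transpose_mul, hT]; noncomm_ring
  rw [this]
  simp only [Matrix.trace, Matrix.diag, Matrix.mul_apply (M := A * A), Matrix.transpose_apply,
    Matrix.mul_apply (M := A), sq]

theorem trace_six {V : Type*} [Fintype V] (A : Matrix V V ℝ) (h : ∀ x y, A x y = A y x) :
    (A ^ 6).trace = ∑ x, ∑ y, (∑ w, A x w * ∑ z, A w z * A z y) ^ 2 := by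
  have hT : A.transpose = A := by ext x y; exact h y x
  have : A ^ 6 = (A * (A * A)) * (A * (A * A)).transpose := by
    rw [Matrix.transpose_mul, Matrix.transpose_mul, hT]; noncomm_ring
  rw [this]
  simp only [Matrix.trace, Matrix.diag, Matrix.mul_apply (M := A * (A * A)),
    Matrix.transpose_apply, Matrix.mul_apply (M := A), sq]

theorem trace_two {V : Type*} [Fintype V] (G : SimpleGraph V)
    (hcard : Fintype.card V = 10) (hreg : G.IsRegularOfDegree 3) :
    (G.adjMatrix ℝ ^ 2).trace = 30 := by
  rw [sq, Matrix.trace]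
  simp only [Matrix.diag, SimpleGraph.adjMatrix_mul_self_apply_self, hreg.degree_eq]
  simp [hcard]
  norm_num

theorem graph_moments {V : Type*} [Fintype V] (G : SimpleGraph V)
    (hcard : Fintype.card V = 10) (hreg : G.IsRegularOfDegree 3) :
    174 ≤ (G.adjMatrix ℝ ^ 4).trace ∨
      (G.adjMatrix ℝ ^ 6).trace + 810 ≤ 12 * (G.adjMatrix ℝ ^ 4).trace := by
  have e : Fin 10 ≃ V := (Fintype.equivFinOfCardEq hcard).symm
  let a : ℕ → ℕ → Bool := fun i j =>
    decide (∃ (hi : i < 10) (hj : j < 10), G.Adj (e ⟨i, hi⟩) (e ⟨j, hj⟩))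
  have ha : ∀ i j : Fin 10, a i j = decide (G.Adj (e i) (e j)) := by
    intro i j
    simp [a]
  have hA : ∀ i j : Fin 10, ((a i j).toNat : ℝ) = G.adjMatrix ℝ (e i) (e j) := by
    intro i j
    rw [ha, SimpleGraph.adjMatrix_apply]
    by_cases h : G.Adj (e i) (e j) <;> simp [h]
  have hsum : ∀ f : V → ℝ, ∑ i : Fin 10, f (e i) = ∑ x, f x := fun f => Equiv.sum_comp e f
  have hc : ∀ i j : Fin 10, (cod a i j : ℝ) =
      ∑ z, G.adjMatrix ℝ (e i) z * G.adjMatrix ℝ z (e j) := by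
    intro i j
    unfold cod
    rw [Finset.sum_range]
    push_cast
    simp_rw [hA]
    exact hsum (fun z => G.adjMatrix ℝ (e i) z * G.adjMatrix ℝ z (e j))
  have hw : ∀ i j : Fin 10, (w3 a i j : ℝ) =
      ∑ w, G.adjMatrix ℝ (e i) w * ∑ z, G.adjMatrix ℝ w z * G.adjMatrix ℝ z (e j) := by
    intro i j
    unfold w3
    rw [Finset.sum_range]
    push_cast
    simp_rw [hA, hc]
    exact hsum (fun w => G.adjMatrix ℝ (e i) w * ∑ z, G.adjMatrix ℝ w z * G.adjMatrix ℝ z (e j))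
  have hsymm : ∀ x y, G.adjMatrix ℝ x y = G.adjMatrix ℝ y x := by
    intro x y
    simp [SimpleGraph.adjMatrix_apply, SimpleGraph.adj_comm]
  have h4 : (M4 a : ℝ) = (G.adjMatrix ℝ ^ 4).trace := by
    rw [trace_four _ hsymm]
    unfold M4
    rw [Finset.sum_range]
    simp_rw [Finset.sum_range]
    push_cast
    simp_rw [hc]
    rw [← hsum]
    exact Finset.sum_congr rfl fun i _ => hsum
      (fun y => (∑ z, G.adjMatrix ℝ (e i) z * G.adjMatrix ℝ z y) ^ 2)
  have h6 : (M6 a : ℝ) = (G.adjMatrix ℝ ^ 6).trace := by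
    rw [trace_six _ hsymm]
    unfold M6
    rw [Finset.sum_range]
    simp_rw [Finset.sum_range]
    push_cast
    simp_rw [hw]
    rw [← hsum]
    exact Finset.sum_congr rfl fun i _ => hsum
      (fun y => (∑ w, G.adjMatrix ℝ (e i) w * ∑ z, G.adjMatrix ℝ w z * G.adjMatrix ℝ z y) ^ 2)
  have hmain := main_nat a ?_ ?_ ?_
  · rw [← h4, ← h6]
    exact_mod_cast hmain
  · intro i j
    simp only [a]
    congr 1
    apply propext
    constructor
    · rintro ⟨h1, h2, h⟩
      exact ⟨h2, h1, h.symm⟩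
    · rintro ⟨h1, h2, h⟩
      exact ⟨h2, h1, h.symm⟩
  · intro i
    simp [a]
  · intro i hi
    rw [Finset.sum_range]
    have h1 : ((∑ j : Fin 10, (a i j).toNat : ℕ) : ℝ) = 3 := by
      push_cast
      have : ∀ j : Fin 10, ((a i j).toNat : ℝ) = G.adjMatrix ℝ (e ⟨i, hi⟩) (e j) :=
        fun j => hA ⟨i, hi⟩ j
      simp_rw [this]
      rw [hsum (fun y => G.adjMatrix ℝ (e ⟨i, hi⟩) y)]
      have h2 := G.adjMatrix_mulVec_const_apply_of_regular (α := ℝ) (a := 1) hreg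
        (v := e ⟨i, hi⟩)
      simpa [Matrix.mulVec, dotProduct] using h2
    exact_mod_cast h1

end CubicTen

theorem randicEnergy_le_of_cubic_card_ten {V : Type*} [Fintype V] (G : SimpleGraph V)
    (hcard : Fintype.card V = 10) (hreg : G.IsRegularOfDegree 3) :
    G.randicEnergy ≤ 16 / 3 := by
  have hR : G.randicMatrix = (1 / 3 : ℝ) • G.adjMatrix ℝ := by
    ext x y
    simp only [SimpleGraph.randicMatrix, Matrix.of_apply, Matrix.smul_apply,
      SimpleGraph.adjMatrix_apply, hreg.degree_eq, smul_eq_mul]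
    have : Real.sqrt (((3 : ℕ) : ℝ) * ((3 : ℕ) : ℝ)) = 3 := by
      rw [Real.sqrt_mul_self] <;> norm_num
    rw [this]
    split_ifs <;> simp
  have hH : G.randicMatrix.IsHermitian := by
    rw [hR]
    ext x y
    simp [SimpleGraph.adjMatrix_apply, SimpleGraph.adj_comm]
  have hrowsum : ∀ x, ∑ y, G.adjMatrix ℝ x y = 3 := by
    intro x
    have h2 := G.adjMatrix_mulVec_const_apply_of_regular (α := ℝ) (a := 1) hreg (v := x)
    simpa [Matrix.mulVec, dotProduct] using h2
  have hE : G.randicEnergy = ∑ i, |hH.eigenvalues i| := by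
    unfold SimpleGraph.randicEnergy matrixEnergy
    rw [dif_pos hH]
  have htr : ∀ k, ∑ i, hH.eigenvalues i ^ k = (1 / 3) ^ k * (G.adjMatrix ℝ ^ k).trace := by
    intro k
    rw [← CubicTen.trace_pow hH k]
    conv_lhs => rw [hR]
    rw [smul_pow, Matrix.trace_smul, smul_eq_mul]
  have h2 := htr 2
  have h4 := htr 4
  have h6 := htr 6
  rw [CubicTen.trace_two G hcard hreg] at h2
  have hconst : ∑ _i : V, (1 : ℝ) = 10 := by simp [hcard]
  rw [hE]
  rcases CubicTen.graph_moments G hcard hreg with hm | hm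
  · have hbd : ∀ i, |hH.eigenvalues i| ≤ 1 := by
      intro i
      have hev : Module.End.HasEigenvalue (Matrix.toLin' G.randicMatrix) (hH.eigenvalues i) := by
        rw [Module.End.hasEigenvalue_iff_mem_spectrum, Matrix.spectrum_toLin']
        exact hH.eigenvalues_mem_spectrum_real i
      obtain ⟨x, hx⟩ := eigenvalue_mem_ball hev
      have hRe : ∀ u v, G.randicMatrix u v = ((1 / 3 : ℝ) • G.adjMatrix ℝ) u v := by
        intro u v
        rw [← hR]
      rw [Metric.mem_closedBall] at hx
      simp only [hRe, Matrix.smul_apply, SimpleGraph.adjMatrix_apply, SimpleGraph.irrefl, if_false,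
        smul_zero, Real.dist_eq, sub_zero] at hx
      refine hx.trans ?_
      calc _ ≤ ∑ y, ‖(1 / 3 : ℝ) • (if G.Adj x y then (1 : ℝ) else 0)‖ :=
            Finset.sum_le_sum_of_subset_of_nonneg (Finset.subset_univ _)
              (fun _ _ _ => norm_nonneg _)
        _ = ∑ y, (1 / 3 : ℝ) * G.adjMatrix ℝ x y := by
            refine Finset.sum_congr rfl fun y _ => ?_
            rw [SimpleGraph.adjMatrix_apply]
            split_ifs <;> simp
        _ = 1 := by
            rw [← Finset.mul_sum, hrowsum]; norm_num
        _ ≤ 1 := le_rfl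
    have hpt : ∀ i, |hH.eigenvalues i| ≤ (1650 / 8670) * 1 +
        (1356 * 9 / 8670) * hH.eigenvalues i ^ 2 - (64 * 81 / 8670) * hH.eigenvalues i ^ 4 := by
      intro i
      have hb := hbd i
      have hn := abs_nonneg (hH.eigenvalues i)
      rw [show hH.eigenvalues i ^ 4 = (hH.eigenvalues i ^ 2) ^ 2 by ring, ← sq_abs]
      generalize |hH.eigenvalues i| = x at hb hn ⊢
      have : 0 ≤ (12 * x - 5) ^ 2 * ((1 - x) * (6 * x + 11)) := by
        apply mul_nonneg (sq_nonneg _)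
        apply mul_nonneg <;> linarith
      nlinarith [this]
    refine (Finset.sum_le_sum fun i _ => hpt i).trans ?_
    rw [Finset.sum_sub_distrib, Finset.sum_add_distrib, ← Finset.mul_sum, ← Finset.mul_sum,
      ← Finset.mul_sum, h2, h4, hconst]
    linarith
  · obtain ⟨i₀, hi₀⟩ : ∃ i, hH.eigenvalues i = 1 := by
      have hmem : (1 : ℝ) ∈ spectrum ℝ G.randicMatrix := by
        rw [← Matrix.spectrum_toLin', ← Module.End.hasEigenvalue_iff_mem_spectrum]
        have hne : Nonempty V := by
          rw [← Fintype.card_pos_iff]; omega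
        refine Module.End.hasEigenvalue_of_hasEigenvector (x := Function.const V (1 : ℝ)) ?_
        rw [Module.End.hasEigenvector_iff, Module.End.mem_eigenspace_iff]
        constructor
        · rw [Matrix.toLin'_apply, hR]
          ext x
          rw [Matrix.smul_mulVec, Pi.smul_apply,
            G.adjMatrix_mulVec_const_apply_of_regular (α := ℝ) (a := 1) hreg (v := x)]
          simp
        · intro h0
          have := congrFun h0 hne.some
          simp at this
      rw [hH.spectrum_real_eq_range_eigenvalues] at hmem
      exact hmem
    have hpt : ∀ i ∈ Finset.univ.erase i₀, |hH.eigenvalues i| ≤ (44 / 324) * 1 +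
        (75 * 9 / 324) * hH.eigenvalues i ^ 2 - (12 * 81 / 324) * hH.eigenvalues i ^ 4 +
        (729 / 324) * hH.eigenvalues i ^ 6 := by
      intro i _
      have hn := abs_nonneg (hH.eigenvalues i)
      rw [show hH.eigenvalues i ^ 4 = (hH.eigenvalues i ^ 2) ^ 2 by ring,
        show hH.eigenvalues i ^ 6 = (hH.eigenvalues i ^ 2) ^ 3 by ring, ← sq_abs]
      generalize |hH.eigenvalues i| = x at hn ⊢
      have : 0 ≤ ((3 * x - 1) * (3 * x - 2)) ^ 2 * (9 * x ^ 2 + 18 * x + 11) := by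
        apply mul_nonneg (sq_nonneg _)
        positivity
      nlinarith [this]
    have hs := Finset.sum_le_sum hpt
    have e1 := Finset.add_sum_erase Finset.univ (fun i => |hH.eigenvalues i|) (Finset.mem_univ i₀)
    have e2 := Finset.add_sum_erase Finset.univ (fun i => (44 / 324) * 1 +
        (75 * 9 / 324) * hH.eigenvalues i ^ 2 - (12 * 81 / 324) * hH.eigenvalues i ^ 4 +
        (729 / 324) * hH.eigenvalues i ^ 6) (Finset.mem_univ i₀)
    have e3 : ∑ i, ((44 / 324) * 1 +
        (75 * 9 / 324) * hH.eigenvalues i ^ 2 - (12 * 81 / 324) * hH.eigenvalues i ^ 4 +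
        (729 / 324) * hH.eigenvalues i ^ 6) = (44 / 324) * 10 + (75 * 9 / 324) * ((1 / 3) ^ 2 * 30)
        - (12 * 81 / 324) * ((1 / 3) ^ 4 * (G.adjMatrix ℝ ^ 4).trace)
        + (729 / 324) * ((1 / 3) ^ 6 * (G.adjMatrix ℝ ^ 6).trace) := by
      rw [Finset.sum_add_distrib, Finset.sum_sub_distrib, Finset.sum_add_distrib,
        ← Finset.mul_sum, ← Finset.mul_sum, ← Finset.mul_sum, ← Finset.mul_sum, h2, h4, h6, hconst]
    rw [e3] at e2
    simp only [hi₀, abs_one, one_pow] at e1 e2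
    linarith
end

section
/- For m ≥ 3 and n ≥ 1, the Randić characteristic polynomial of the Dutch windmill graph D_m^n satisfies RP(D_m^n, λ) = Λ_{m−1}^{n−1} · RP(C_m, λ), where Λ_1 = λ, Λ_2 = λ² − 1/4, and Λ_k = λ·Λ_{k−1} − (1/4)·Λ_{k−2} for every k ≥ 3. -/
open scoped Classical

/-- The Dutch windmill graph `D_m^n`, obtained from `n` disjoint copies of the cycle `C_m`
by identifying one vertex from each copy into a single common vertex (the hub `none`).
Each copy `i` is the cycle `none — (i,0) — (i,1) — ⋯ — (i,m-2) — none`. -/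
def dutchWindmill (m n : ℕ) : SimpleGraph (Option (Fin n × Fin (m - 1))) :=
  SimpleGraph.fromRel fun x y =>
    match x, y with
    | none, some (_, j) => j.val = 0 ∨ j.val = m - 2
    | some (i, j), some (i', j') => i = i' ∧ j.val + 1 = j'.val
    | _, _ => False

open Polynomial in
/-- The polynomials `Λ_k`: `Λ_1 = λ`, `Λ_2 = λ² - 1/4`, and
`Λ_k = λ·Λ_{k-1} - (1/4)·Λ_{k-2}` for `k ≥ 3`. -/
noncomputable def Lam : ℕ → Polynomial ℝ
  | 0 => 1
  | 1 => X
  | 2 => X ^ 2 - C (1 / 4 : ℝ)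
  | (k + 3) => X * Lam (k + 2) - C (1 / 4 : ℝ) * Lam (k + 1)

open Polynomial in
/-- characteristic matrix of the path block. -/
noncomputable def pathMat (k : ℕ) : Matrix (Fin k) (Fin k) (Polynomial ℝ) :=
  Matrix.of fun i j =>
    if i = j then X else if i.val + 1 = j.val ∨ j.val + 1 = i.val then C (-1/2 : ℝ) else 0

theorem pathMat_det_succ (k : ℕ) :
    (pathMat (k+2)).det = Polynomial.X * (pathMat (k+1)).det
      - Polynomial.C (1/4 : ℝ) * (pathMat k).det := by
  rw [Matrix.det_succ_row_zero, Fin.sum_univ_succ, Fin.sum_univ_succ, Finset.sum_eq_zero]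
  · have h1 : (pathMat (k+2)).submatrix Fin.succ (Fin.succAbove 0) = pathMat (k+1) := by
      ext1 i j
      simp [pathMat]
    have h2 : ((pathMat (k+2)).submatrix Fin.succ (Fin.succAbove (Fin.succ 0))).det
        = Polynomial.C (-1/2 : ℝ) * (pathMat k).det := by
      rw [Matrix.det_succ_column_zero, Fin.sum_univ_succ, Finset.sum_eq_zero]
      · have h3 : ((pathMat (k+2)).submatrix Fin.succ (Fin.succAbove (Fin.succ 0))).submatrix
            (Fin.succAbove 0) Fin.succ = pathMat k := by
          ext1 i j
          simp [pathMat, Fin.succAbove, Fin.lt_def, Fin.ext_iff]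
        rw [h3]
        simp [pathMat, Fin.succAbove, Fin.lt_def, Fin.ext_iff]
      · intro i _
        simp [pathMat, Fin.succAbove, Fin.lt_def, Fin.ext_iff]
    rw [h1, h2]
    have h4 : (Polynomial.C (1/4 : ℝ)) = Polynomial.C (-1/2 : ℝ) * Polynomial.C (-1/2 : ℝ) := by
      rw [← Polynomial.C_mul]; norm_num
    rw [h4]
    simp [pathMat]
    ring
  · intro i _
    simp [pathMat, Fin.ext_iff]

theorem pathMat_det : ∀ k : ℕ, (pathMat k).det = Lam k
  | 0 => by simp [Lam]
  | 1 => by simp [Lam, pathMat]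
  | 2 => by
    rw [pathMat_det_succ, pathMat_det 1, pathMat_det 0]
    simp only [Lam]; ring
  | (k+3) => by
    rw [pathMat_det_succ, pathMat_det (k+2), pathMat_det (k+1)]
    simp only [Lam]

theorem Lam_ne_zero (k : ℕ) : Lam k ≠ 0 := by
  have h : pathMat k = (Matrix.of fun i j : Fin k =>
      if i.val + 1 = j.val ∨ j.val + 1 = i.val then (1/2 : ℝ) else 0).charmatrix := by
    ext1 i j
    by_cases hij : i = j
    · subst hij; simp [pathMat]
    · simp only [pathMat, Matrix.of_apply, hij, if_false, Matrix.charmatrix_apply,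
        Matrix.diagonal_apply]
      have h12 : Polynomial.C (-1/2 : ℝ) = - Polynomial.C (1/2 : ℝ) := by
        rw [← Polynomial.C_neg]; norm_num
      split_ifs <;> simp [h12]
  rw [← pathMat_det, h]
  exact (Matrix.charpoly_monic _).ne_zero

/-- generic bordered block matrix -/
def bordMat {K : Type*} [Field K] (n k : ℕ) (a c : K) (u : Fin k → K)
    (P : Matrix (Fin k) (Fin k) K) : Matrix (Option (Fin n × Fin k)) (Option (Fin n × Fin k)) K :=
  Matrix.of fun x y => match x, y with
    | none, none => a
    | none, some p => c * u p.2
    | some p, none => c * u p.2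
    | some p, some q => if p.1 = q.1 then P p.2 q.2 else 0

theorem bordMat_det {K : Type*} [Field K] (n k : ℕ) (a c : K) (u : Fin k → K)
    (P : Matrix (Fin k) (Fin k) K) (hP : P.det ≠ 0) :
    (bordMat n k a c u P).det = P.det ^ n * (a - n * c ^ 2 * (u ⬝ᵥ (P⁻¹.mulVec u))) := by
  let e : (Fin n × Fin k) ⊕ Unit ≃ Option (Fin n × Fin k) := (Equiv.optionEquivSumPUnit _).symm
  let D : Matrix (Fin n × Fin k) (Fin n × Fin k) K :=
    Matrix.kroneckerMap (· * ·) (1 : Matrix (Fin n) (Fin n) K) P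
  let D' : Matrix (Fin n × Fin k) (Fin n × Fin k) K :=
    Matrix.kroneckerMap (· * ·) (1 : Matrix (Fin n) (Fin n) K) P⁻¹
  have hDD : D * D' = 1 := by
    simp only [D, D']
    rw [← Matrix.mul_kronecker_mul, Matrix.mul_nonsing_inv _ (isUnit_iff_ne_zero.2 hP)]
    simp
  have hD : D.det = P.det ^ n := by
    simp only [D]
    rw [Matrix.det_kronecker]; simp
  have hinv : D⁻¹ = D' := Matrix.inv_eq_right_inv hDD
  have hb : (bordMat n k a c u P).submatrix e e = Matrix.fromBlocks D
      (Matrix.of fun p _ => c * u p.2) (Matrix.of fun _ p => c * u p.2)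
      (Matrix.of fun _ _ => a) := by
    ext1 x y
    rcases x with ⟨i, j⟩ | x <;> rcases y with ⟨i', j'⟩ | y <;>
      simp [e, bordMat, D, Matrix.one_apply]
  letI : Invertible D := Matrix.invertibleOfIsUnitDet D (by
    rw [hD]; exact isUnit_iff_ne_zero.2 (pow_ne_zero _ hP))
  rw [← Matrix.det_submatrix_equiv_self e, hb, Matrix.det_fromBlocks₁₁, hD,
    Matrix.invOf_eq_nonsing_inv, hinv]
  congr 1
  simp only [Matrix.det_unique, Matrix.sub_apply, Matrix.of_apply, Matrix.mul_apply,
    Fintype.sum_prod_type, D', Matrix.kroneckerMap_apply, Matrix.one_apply, dotProduct,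
    Matrix.mulVec]
  congr 1
  simp only [ite_mul, one_mul, zero_mul, mul_ite, mul_zero]
  have : ∀ x : Fin n, ∀ y : Fin k, (∑ x1 : Fin n, ∑ x2 : Fin k,
      if x1 = x then c * u x2 * P⁻¹ x2 y else 0) = ∑ x2, c * u x2 * P⁻¹ x2 y := by
    intro x y
    rw [Finset.sum_comm]; simp
  simp only [this]
  simp only [Finset.sum_const, Finset.card_univ, Fintype.card_fin, nsmul_eq_mul, mul_assoc]
  congr 1
  simp only [Finset.mul_sum, Finset.sum_mul]
  rw [Finset.sum_comm]
  refine Finset.sum_congr rfl fun i _ => Finset.sum_congr rfl fun j _ => by ring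

/-- The real model matrix. -/
noncomputable def modelMat (n k : ℕ) (c : ℝ) :
    Matrix (Option (Fin n × Fin k)) (Option (Fin n × Fin k)) ℝ :=
  Matrix.of fun x y => match x, y with
    | none, none => 0
    | none, some p => if p.2.val = 0 ∨ p.2.val + 1 = k then c else 0
    | some p, none => if p.2.val = 0 ∨ p.2.val + 1 = k then c else 0
    | some p, some q => if p.1 = q.1 ∧ (p.2.val + 1 = q.2.val ∨ q.2.val + 1 = p.2.val)
        then 1/2 else 0

theorem modelMat_charpoly (n k : ℕ) (hn : 1 ≤ n) (c : ℝ) (hc : n * c ^ 2 = 1/4) :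
    (modelMat n k c).charpoly = Lam k ^ (n-1) * (modelMat 1 k (1/2)).charpoly := by
  let K := FractionRing (Polynomial ℝ)
  let φ : Polynomial ℝ →+* K := algebraMap (Polynomial ℝ) K
  have hφ : Function.Injective φ := IsFractionRing.injective (Polynomial ℝ) K
  let u : Fin k → K := fun j => if j.val = 0 ∨ j.val + 1 = k then 1 else 0
  have hPd : (φ.mapMatrix (pathMat k)).det = φ (Lam k) := by
    rw [← RingHom.map_det, pathMat_det]
  have hP : (φ.mapMatrix (pathMat k)).det ≠ 0 := by
    rw [hPd]
    exact (map_ne_zero_iff φ hφ).2 (Lam_ne_zero k)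
  have key : ∀ (n : ℕ) (c : ℝ), φ (modelMat n k c).charpoly =
      (bordMat n k (φ Polynomial.X) (φ (Polynomial.C (-c))) u (φ.mapMatrix (pathMat k))).det := by
    intro n c
    rw [Matrix.charpoly, RingHom.map_det]
    congr 1
    ext1 x y
    rcases x with _ | ⟨i, j⟩ <;> rcases y with _ | ⟨i', j'⟩
    · simp [bordMat, modelMat]
    · simp only [RingHom.mapMatrix_apply, Matrix.map_apply, Matrix.charmatrix_apply, bordMat,
        modelMat, Matrix.of_apply, u]
      split_ifs <;> simp
    · simp only [RingHom.mapMatrix_apply, Matrix.map_apply, Matrix.charmatrix_apply, bordMat,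
        modelMat, Matrix.of_apply, u]
      split_ifs <;> simp
    · simp only [RingHom.mapMatrix_apply, Matrix.map_apply, Matrix.charmatrix_apply, bordMat,
        modelMat, Matrix.of_apply, pathMat, Matrix.diagonal_apply, Option.some.injEq,
        Prod.mk.injEq]
      have h12 : Polynomial.C (-1/2 : ℝ) = - Polynomial.C (1/2 : ℝ) := by
        rw [← Polynomial.C_neg]; norm_num
      by_cases h1 : i = i' <;> by_cases h2 : j = j' <;> simp [h1, h2, h12] 
      split_ifs <;> simp
  apply hφ
  rw [map_mul, map_pow, key, key, bordMat_det _ _ _ _ _ _ hP, bordMat_det _ _ _ _ _ _ hP, hPd]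
  have e1 : (n : K) * (φ (Polynomial.C (-c)))^2 = φ (Polynomial.C (1/4)) := by
    rw [← hc]; simp
  have e2 : ((1:ℕ) : K) * (φ (Polynomial.C (-(1/2))))^2 = φ (Polynomial.C (1/4)) := by
    rw [Nat.cast_one, one_mul, ← map_pow, ← Polynomial.C_pow]; norm_num
  rw [e1, e2, ← mul_assoc, ← pow_add, Nat.sub_add_cancel hn]

theorem fin_sub_one (N : ℕ) (hN : 2 ≤ N) (u v : Fin N) :
    (u - v).val = 1 ↔ (u.val = v.val + 1 ∨ (u.val = 0 ∧ v.val + 1 = N)) := by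
  have hu := u.isLt
  have hv := v.isLt
  rcases le_or_gt v u with h | h
  · rw [Fin.sub_val_of_le h]
    have : v.val ≤ u.val := h
    omega
  · rw [Fin.coe_sub_iff_lt.2 h]
    have : u.val < v.val := h
    omega

theorem cycle_model (k : ℕ) (hk : 2 ≤ k) :
    (SimpleGraph.cycleGraph (k+1)).randicCharpoly = (modelMat 1 k (1/2)).charpoly := by
  obtain ⟨l, rfl⟩ : ∃ l, k = l + 2 := ⟨k - 2, by omega⟩
  let e : Fin (l+2+1) ≃ Option (Fin 1 × Fin (l+2)) :=
    (finSuccEquiv (l+2)).trans (Equiv.optionCongr (Equiv.uniqueProd (Fin (l+2)) (Fin 1)).symm)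
  have hre : (SimpleGraph.cycleGraph (l+2+1)).randicCharpoly =
      (Matrix.reindex e e (SimpleGraph.cycleGraph (l+2+1)).randicMatrix).charpoly := by
    rw [SimpleGraph.randicCharpoly]
    convert (Matrix.charpoly_reindex e (SimpleGraph.cycleGraph (l+2+1)).randicMatrix).symm
  rw [hre]
  congr 1
  have hdeg : ∀ (v : Fin (l+2+1)) [Fintype ((SimpleGraph.cycleGraph (l+2+1)).neighborSet v)],
      (SimpleGraph.cycleGraph (l+2+1)).degree v = 2 := by
    intro v _
    convert SimpleGraph.cycleGraph_degree_three_le (n := l) (v := v)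
  have hs : √((2:ℝ) * 2) = 2 := Real.sqrt_mul_self (by norm_num)
  have e0 : e.symm none = ⟨0, by omega⟩ := by simp [e]
  have e1 : ∀ p, e.symm (some p) = p.2.succ := by intro p; simp [e]
  ext1 x y
  simp only [Matrix.reindex_apply, Matrix.submatrix_apply, SimpleGraph.randicMatrix,
    Matrix.of_apply, hdeg, SimpleGraph.cycleGraph_adj']
  rcases x with _ | ⟨i, j⟩ <;> rcases y with _ | ⟨i', j'⟩ <;>
    simp only [e0, e1, modelMat, Matrix.of_apply, Nat.cast_ofNat, hs]
  · simp
  · apply if_congr _ rfl rfl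
    have := j'.isLt
    simp only [fin_sub_one _ (show 2 ≤ l + 2 + 1 by omega), Fin.val_succ, true_and]
    omega
  · apply if_congr _ rfl rfl
    have := j.isLt
    simp only [fin_sub_one _ (show 2 ≤ l + 2 + 1 by omega), Fin.val_succ, true_and]
    omega
  · apply if_congr _ rfl rfl
    have := j.isLt
    have := j'.isLt
    have h := Subsingleton.elim i i'
    simp only [fin_sub_one _ (show 2 ≤ l + 2 + 1 by omega), Fin.val_succ, h, true_and]
    omega

theorem windmill_model (k n : ℕ) (hk : 2 ≤ k) (hn : 1 ≤ n) :
    (dutchWindmill (k+1) n).randicMatrix = modelMat n k (1 / √(2 * n * 2)) := by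
  have adj0 : ∀ p : Fin n × Fin k, (dutchWindmill (k+1) n).Adj none (some p) ↔
      (p.2.val = 0 ∨ p.2.val + 1 = k) := by
    intro p
    simp [dutchWindmill]
    omega
  have adj1 : ∀ p q : Fin n × Fin k, (dutchWindmill (k+1) n).Adj (some p) (some q) ↔
      (p.1 = q.1 ∧ (p.2.val + 1 = q.2.val ∨ q.2.val + 1 = p.2.val)) := by
    rintro ⟨i, j⟩ ⟨i', j'⟩
    simp only [dutchWindmill, SimpleGraph.fromRel_adj, ne_eq, Option.some.injEq, Prod.mk.injEq]
    grind
  have deg0 : (dutchWindmill (k+1) n).degree none = 2 * n := by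
    have h : (dutchWindmill (k+1) n).neighborFinset none =
        ((Finset.univ : Finset (Fin n)) ×ˢ
          ({⟨0, by omega⟩, ⟨k-1, by omega⟩} : Finset (Fin k))).map Function.Embedding.some := by
      ext x
      rcases x with _ | p
      · simp
      · simp only [SimpleGraph.mem_neighborFinset, adj0]
        simp [Fin.ext_iff]
        omega
    rw [← SimpleGraph.card_neighborFinset_eq_degree, h, Finset.card_map, Finset.card_product,
      Finset.card_pair (by simp [Fin.ext_iff]; omega)]
    simp [mul_comm]
  have deg1 : ∀ p, (dutchWindmill (k+1) n).degree (some p) = 2 := by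
    rintro ⟨i, j⟩
    have hj := j.isLt
    have h : (dutchWindmill (k+1) n).neighborFinset (some (i, j)) =
        {if j.val = 0 then none else some (i, ⟨j.val - 1, by omega⟩),
          if h : j.val + 1 = k then none else some (i, ⟨j.val + 1, by omega⟩)} := by
      ext x
      rcases x with _ | ⟨i', j'⟩
      · rw [SimpleGraph.mem_neighborFinset, SimpleGraph.adj_comm, adj0, Finset.mem_insert,
          Finset.mem_singleton]
        split_ifs <;> simp <;> omega
      · rw [SimpleGraph.mem_neighborFinset, adj1, Finset.mem_insert, Finset.mem_singleton]
        have := j'.isLt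
        split_ifs <;> simp [Fin.ext_iff] <;> omega
    rw [← SimpleGraph.card_neighborFinset_eq_degree, h, Finset.card_pair]
    split_ifs <;> simp <;> omega
  ext1 x y
  rcases x with _ | p <;> rcases y with _ | q
  · simp [SimpleGraph.randicMatrix, modelMat]
  · simp only [SimpleGraph.randicMatrix, modelMat, Matrix.of_apply, adj0, deg0, deg1]
    push_cast; rfl
  · simp only [SimpleGraph.randicMatrix, modelMat, Matrix.of_apply, adj0, deg0, deg1,
      SimpleGraph.adj_comm _ (some p) none]
    push_cast; rw [mul_comm 2 (2 * (n:ℝ))]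
  · have hs : √((2:ℝ) * 2) = 2 := Real.sqrt_mul_self (by norm_num)
    simp only [SimpleGraph.randicMatrix, modelMat, Matrix.of_apply, adj1, deg1, Nat.cast_ofNat, hs]

theorem randicCharpoly_dutchWindmill (m n : ℕ) (hm : 3 ≤ m) (hn : 1 ≤ n) :
    (dutchWindmill m n).randicCharpoly =
      Lam (m - 1) ^ (n - 1) * (SimpleGraph.cycleGraph m).randicCharpoly := by
  obtain ⟨k, rfl⟩ : ∃ k, m = k + 1 := ⟨m - 1, by omega⟩
  rw [cycle_model k (by omega)]
  have h := windmill_model k n (by omega) hn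
  have hn' : (n : ℝ) ≠ 0 := by positivity
  have h2 := modelMat_charpoly n k hn (1 / √(2 * n * 2)) (by
    rw [div_pow, Real.sq_sqrt (by positivity)]; field_simp; norm_num)
  rw [← h] at h2
  rw [SimpleGraph.randicCharpoly]
  convert h2 <;> omega
end
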